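/- arXiv:2511.10339 — 2 statements merged into one kernel-verified Lean document; each statement's English description precedes it below -/
import Mathlib

section
/- Atomic induction step of Theorem 2, forward direction. Let C be a finite nonempty set with two distinguished distinct elements w and w', and let pn₀, dn₀, pn, dn : C → ℕ∞ satisfy pn₀(c) = pn(c) and dn₀(c) = dn(c) for every c ≠ w, pn₀(c) ≠ ∞ for every c ∈ C, and pn₀(w) ≠ ∞, dn₀(w) ≠ ∞. Define pn(v) = min_{c∈C} dn(c), dn(v) = Σ_{c∈C} pn(c), pn₀(v) = min_{c∈C} dn₀(c), dn₀(v) = Σ_{c∈C} pn₀(c). Let pt(v), dt(v), mt(v), ps(v), ds(v) ∈ ℕ∞ and define pt(w) = dt(v) − dn₀(v) + pn₀(w), dt(w) = min{pt(v), dn₀(w') + 1}, mt(w) = mt(v), ps(w) = ds(v) + dn₀(v) − pn₀(w), ds(w) = ps(v). Assume that dn(w) ≤ dn(c) for every c ∈ C, and that pn(v) < pt(v), dn(v) < dt(v), and min{pn(v) + ps(v), dn(v) + ds(v)} < mt(v). Then pn(w) < pt(w), dn(w) < dt(w), and min{pn(w) + ps(w), dn(w) + ds(w)} < mt(w). -/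
/-- Atomic induction step of the DFPN-with-Grundy-numbers threshold theorem, forward
direction.  `C` is the (finite, nonempty) set of children of the atomic node `v`, with
selected child `w` and a second distinguished child `w'`.  Here
`pn(v) = ⨅ c, dn c`, `dn(v) = ∑ c, pn c`, `dn₀(v) = ∑ c, pn₀ c`, and the thresholds of
`w` are defined from those of `v` as in the algorithm.  If `w` has the smallest disproof
number among the children of `v` and the three threshold inequalities hold at `v`, then
they hold at `w`. -/
theorem atomic_step_forward {C : Type} [Fintype C] [Nonempty C]
    (w w' : C) (hww' : w ≠ w')
    (pn₀ dn₀ pn dn : C → ℕ∞)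
    (hpn0 : ∀ c, c ≠ w → pn₀ c = pn c) (hdn0 : ∀ c, c ≠ w → dn₀ c = dn c)
    (hfin : ∀ c, pn₀ c ≠ ⊤) (hpn0w : pn₀ w ≠ ⊤) (hdn0w : dn₀ w ≠ ⊤)
    (ptv dtv mtv psv dsv : ℕ∞)
    (ptw dtw mtw psw dsw : ℕ∞)
    (hptw : ptw = dtv - (∑ c, pn₀ c) + pn₀ w)
    (hdtw : dtw = min ptv (dn₀ w' + 1))
    (hmtw : mtw = mtv)
    (hpsw : psw = dsv + (∑ c, pn₀ c) - pn₀ w)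
    (hdsw : dsw = psv)
    (hmin : ∀ c, dn w ≤ dn c)
    (h1 : (⨅ c, dn c) < ptv)
    (h2 : (∑ c, pn c) < dtv)
    (h3 : min ((⨅ c, dn c) + psv) ((∑ c, pn c) + dsv) < mtv) :
    pn w < ptw ∧ dn w < dtw ∧ min (pn w + psw) (dn w + dsw) < mtw := by
  classical
  have hinf : (⨅ c, dn c) = dn w := le_antisymm (iInf_le _ w) (le_iInf hmin)
  have hpn : ∑ c, pn c = pn w + ∑ c ∈ Finset.univ.erase w, pn c :=
    (Finset.add_sum_erase _ _ (Finset.mem_univ w)).symm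
  have hpn₀ : ∑ c, pn₀ c = pn₀ w + ∑ c ∈ Finset.univ.erase w, pn c := by
    rw [← Finset.add_sum_erase _ _ (Finset.mem_univ w)]
    exact congrArg _ (Finset.sum_congr rfl fun c hc => hpn0 c (Finset.ne_of_mem_erase hc))
  rw [hinf] at h1 h3
  rw [hpn] at h2 h3
  rw [hpn₀] at hptw hpsw
  generalize (∑ c ∈ Finset.univ.erase w, pn c) = R at *
  subst hptw hdtw hmtw hpsw hdsw
  refine ⟨?_, lt_min h1 ?_, ?_⟩
  · calc pn w < dtv - R := lt_tsub_iff_right.2 h2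
      _ ≤ dtv - R - pn₀ w + pn₀ w := le_tsub_add
      _ = dtv - (pn₀ w + R) + pn₀ w := by rw [tsub_tsub, add_comm R]
  · have hle : dn w ≤ dn₀ w' := hdn0 w' hww'.symm ▸ hmin w'
    exact ENat.lt_add_one_iff' h1.ne_top |>.2 hle
  · have hps : dsv + (pn₀ w + R) - pn₀ w = R + dsv := by
      rw [show dsv + (pn₀ w + R) = R + dsv + pn₀ w by ring]
      exact (ENat.addLECancellable_of_ne_top hpn0w).add_tsub_cancel_right
    rwa [hps, ← add_assoc, min_comm]
end

section
/- Decomposable induction step of Theorem 2 (last child not yet generated), forward direction. Let C be a finite nonempty set with a distinguished element w, and let pn₀, dn₀, pn, dn : C → ℕ∞ satisfy pn₀(c) = pn(c) and dn₀(c) = dn(c) for every c ≠ w, and min{pn₀(w), dn₀(w)} ≠ ∞. Define pn(v) = dn(v) = Σ_{c∈C} min{pn(c), dn(c)} and pn₀(v) = Σ_{c∈C} min{pn₀(c), dn₀(c)}. Let pt(v), dt(v), mt(v) ∈ ℕ∞ and ps(v), ds(v) ∈ ℕ∞ with ps(v) ≠ ∞ and ds(v) ≠ ∞, and define t(v) =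 min{pt(v), dt(v), mt(v) − min{ps(v), ds(v)}}, pt(w) = dt(w) = ∞, mt(w) = t(v) − pn₀(v) + min{pn₀(w), dn₀(w)}, ps(w) = ds(w) = 0. Assume pn(v) < pt(v), dn(v) < dt(v), min{pn(v) + ps(v), dn(v) + ds(v)} < mt(v), and that pn(w) ≠ ∞ and dn(w) ≠ ∞. Then pn(w) < pt(w), dn(w) < dt(w), and min{pn(w) + ps(w), dn(w) + ds(w)} < mt(w). -/
/-- Decomposable induction step (last child not yet generated) of the
DFPN-with-Grundy-numbers threshold theorem, forward direction.  `C` is the (finite,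
nonempty) set of children of the decomposable node `v`, with selected child `w`.  Here
`pn(v) = dn(v) = ∑ c, min (pn c) (dn c)`, `pn₀(v) = ∑ c, min (pn₀ c) (dn₀ c)`, and the
thresholds of `w` are defined from those of `v` as in the algorithm.  If the three
threshold inequalities hold at `v` and `pn w`, `dn w` are finite, then the three
threshold inequalities hold at `w`. -/
theorem decomposable_step_forward {C : Type} [Fintype C] [Nonempty C]
    (w : C)
    (pn₀ dn₀ pn dn : C → ℕ∞)
    (hpn0 : ∀ c, c ≠ w → pn₀ c = pn c) (hdn0 : ∀ c, c ≠ w → dn₀ c = dn c)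
    (hfinw : min (pn₀ w) (dn₀ w) ≠ ⊤)
    (ptv dtv mtv psv dsv : ℕ∞) (hpsv : psv ≠ ⊤) (hdsv : dsv ≠ ⊤)
    (t ptw dtw mtw psw dsw : ℕ∞)
    (ht : t = min ptv (min dtv (mtv - min psv dsv)))
    (hptw : ptw = ⊤) (hdtw : dtw = ⊤)
    (hmtw : mtw = t - (∑ c, min (pn₀ c) (dn₀ c)) + min (pn₀ w) (dn₀ w))
    (hpsw : psw = 0) (hdsw : dsw = 0)
    (h1 : (∑ c, min (pn c) (dn c)) < ptv)
    (h2 : (∑ c, min (pn c) (dn c)) < dtv)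
    (h3 : min ((∑ c, min (pn c) (dn c)) + psv) ((∑ c, min (pn c) (dn c)) + dsv) < mtv)
    (hpnw : pn w ≠ ⊤) (hdnw : dn w ≠ ⊤) :
    pn w < ptw ∧ dn w < dtw ∧ min (pn w + psw) (dn w + dsw) < mtw := by
  classical
  subst hptw hdtw hpsw hdsw hmtw
  refine ⟨hpnw.lt_top, hdnw.lt_top, ?_⟩
  have hSt : ∑ c, min (pn c) (dn c) < t := by
    rw [ht]
    refine lt_min h1 (lt_min h2 ?_)
    rwa [min_add_add_left, ← lt_tsub_iff_right] at h3
  have hrest : ∑ c ∈ Finset.univ.erase w, min (pn₀ c) (dn₀ c)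
      = ∑ c ∈ Finset.univ.erase w, min (pn c) (dn c) :=
    Finset.sum_congr rfl fun c hc => by
      rw [hpn0 c (Finset.ne_of_mem_erase hc), hdn0 c (Finset.ne_of_mem_erase hc)]
  rw [← Finset.sum_erase_add _ _ (Finset.mem_univ w), ← lt_tsub_iff_left] at hSt
  rw [← Finset.sum_erase_add _ _ (Finset.mem_univ w), hrest, tsub_add_eq_tsub_tsub,
    add_zero, add_zero]
  exact hSt.trans_le le_tsub_add
end
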